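/- arXiv:2111.02846 — 3 statements merged into one kernel-verified Lean document; each statement's English description precedes it below -/
import Mathlib

section
/- Let k ≥ 0. For all points x ≠ z of ℝ³, one has |∇_x(Φ_k − Φ_0)(x,z)| ≤ k²/(8π). -/
noncomputable section

/-- The fundamental solution `Φ_k(x,z) = e^{ik|x−z|}/(4π|x−z|)` of the Helmholtz
equation `Δu + k²u = 0` in `ℝ³`. -/
def Phi (k : ℝ) (x z : EuclideanSpace ℝ (Fin 3)) : ℂ :=
  Complex.exp (Complex.I * k * ‖x - z‖) / (4 * Real.pi * ‖x - z‖)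

theorem norm_mul_exp_sub_exp_add_one_le {t : ℝ} (ht : 0 ≤ t) :
    ‖Complex.I * t * Complex.exp (Complex.I * t) - Complex.exp (Complex.I * t) + 1‖
      ≤ t ^ 2 / 2 := by
  have hderiv : ∀ s : ℝ, HasDerivAt
      (fun s : ℝ => Complex.I * s * Complex.exp (Complex.I * s) - Complex.exp (Complex.I * s) + 1)
      (-s * Complex.exp (Complex.I * s)) s := by
    intro s
    have hlin : HasDerivAt (fun s : ℝ => Complex.I * (s : ℂ)) Complex.I s := by
      simpa using (Complex.ofRealCLM.hasDerivAt (x := s)).const_mul Complex.I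
    refine (((hlin.mul hlin.cexp).sub hlin.cexp).add_const 1).congr_deriv ?_
    linear_combination ((s : ℂ) * Complex.exp (Complex.I * s)) * Complex.I_sq
  have hquad : ∀ s : ℝ, HasDerivAt (fun s : ℝ => s ^ 2 / 2) s s := by
    intro s
    simpa using (hasDerivAt_pow 2 s).div_const 2
  refine image_norm_le_of_norm_deriv_right_le_deriv_boundary (a := 0) (b := t)
    (fun s _ => (hderiv s).continuousAt.continuousWithinAt)
    (fun s _ => (hderiv s).hasDerivWithinAt) (by simp) hquad ?_ ⟨ht, le_rfl⟩
  intro s hs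
  rw [norm_mul, mul_comm Complex.I, Complex.norm_exp_ofReal_mul_I, norm_neg, Complex.norm_real,
    Real.norm_of_nonneg hs.1, mul_one]

/-- The radial profile of `Φ_k − Φ_0` and its derivative. -/
theorem hasDerivAt_radial_Phi_sub (k : ℝ) {r : ℝ} (hr : r ≠ 0) :
    HasDerivAt
      (fun r : ℝ => (Complex.exp (Complex.I * k * r) - 1) / (4 * Real.pi * r))
      ((Complex.I * (k * r : ℝ) * Complex.exp (Complex.I * (k * r : ℝ))
        - Complex.exp (Complex.I * (k * r : ℝ)) + 1) / (4 * Real.pi * r ^ 2)) r := by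
  have hr' : (r : ℂ) ≠ 0 := by exact_mod_cast hr
  have hlin : ∀ c : ℂ, HasDerivAt (fun r : ℝ => c * (r : ℂ)) c r := fun c => by
    simpa using (Complex.ofRealCLM.hasDerivAt (x := r)).const_mul c
  refine (((hlin (Complex.I * k)).cexp.sub_const 1).div (hlin (4 * Real.pi))
    (by simp [hr, Real.pi_ne_zero])).congr_deriv ?_
  push_cast
  rw [← mul_assoc Complex.I]
  field_simp
  ring

/-- **Gradient bound for the difference kernel.** For `k ≥ 0` and all `x ≠ z` in `ℝ³`,
`|∇_x(Φ_k − Φ_0)(x,z)| ≤ k²/(8π)`. -/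
theorem stmt_5 (k : ℝ) (hk : 0 ≤ k) (x z : EuclideanSpace ℝ (Fin 3)) (hxz : x ≠ z) :
    ‖fderiv ℝ (fun y => Phi k y z - Phi 0 y z) x‖ ≤ k ^ 2 / (8 * Real.pi) := by
  have hr : 0 < ‖x - z‖ := norm_pos_iff.2 (sub_ne_zero.2 hxz)
  have hradial : (fun y => Phi k y z - Phi 0 y z) =
      (fun r : ℝ => (Complex.exp (Complex.I * k * r) - 1) / (4 * Real.pi * r)) ∘
        fun y => ‖y - z‖ := by
    funext y
    simp [Phi, sub_div]
  have hdist : DifferentiableAt ℝ (fun y => ‖y - z‖) x :=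
    (differentiableAt_id.sub_const z).norm ℝ (sub_ne_zero.2 hxz)
  have hlip : LipschitzWith 1 (fun y => ‖y - z‖) :=
    LipschitzWith.of_dist_le_mul fun a b => by
      simpa [dist_eq_norm] using abs_norm_sub_norm_le (a - z) (b - z)
  have hdist_le : ‖fderiv ℝ (fun y => ‖y - z‖) x‖ ≤ 1 := by
    simpa using norm_fderiv_le_of_lipschitz ℝ (x₀ := x) hlip
  rw [hradial,
    ((hasDerivAt_radial_Phi_sub k hr.ne').hasFDerivAt.comp x hdist.hasFDerivAt).fderiv]
  refine (ContinuousLinearMap.opNorm_comp_le _ _).trans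
    ((mul_le_of_le_one_right (norm_nonneg _) hdist_le).trans ?_)
  rw [ContinuousLinearMap.norm_toSpanSingleton, norm_div]
  have hden : ‖(4 * Real.pi * (‖x - z‖ : ℂ) ^ 2 : ℂ)‖ = 4 * Real.pi * ‖x - z‖ ^ 2 := by
    simp [abs_of_pos Real.pi_pos]
  rw [hden, div_le_iff₀ (by positivity)]
  refine (norm_mul_exp_sub_exp_add_one_le (by positivity)).trans_eq ?_
  field_simp
  ring

end
end

section
/- Let k ≥ 0. For all points x ≠ z of ℝ³, the 3×3 complex matrix Π_k(x,z) − Π_0(x,z) satisfies the operator-norm bound ‖Π_k(x,z) − Π_0(x,z)‖ ≤ 3k²/|x−z| + k³. -/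
noncomputable section

/-- The Hessian matrix (in the first variable) of `Φ_k(·,z)` at `x`. -/
def PhiHess (k : ℝ) (x z : EuclideanSpace ℝ (Fin 3)) : Matrix (Fin 3) (Fin 3) ℂ :=
  Matrix.of fun i j =>
    fderiv ℝ (fun y => fderiv ℝ (fun w => Phi k w z) y (EuclideanSpace.single j 1)) x
      (EuclideanSpace.single i 1)

/-- The electromagnetic dyadic Green's kernel
`Π_k(x,z) = k² Φ_k(x,z) I₃ + Hess_x Φ_k(x,z)`. -/
def PiK (k : ℝ) (x z : EuclideanSpace ℝ (Fin 3)) : Matrix (Fin 3) (Fin 3) ℂ :=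
  ((k : ℂ) ^ 2 * Phi k x z) • (1 : Matrix (Fin 3) (Fin 3) ℂ) + PhiHess k x z

theorem hasFDerivAt_norm_sub_const {E : Type*} [NormedAddCommGroup E] [InnerProductSpace ℝ E]
    {y z : E} (h : y ≠ z) :
    HasFDerivAt (fun w => ‖w - z‖) (‖y - z‖⁻¹ • innerSL ℝ (y - z)) y := by
  have h0 : ‖y - z‖ ≠ 0 := norm_ne_zero_iff.2 (sub_ne_zero.2 h)
  have h1 : HasFDerivAt (fun w => ‖w - z‖ ^ 2) (2 • innerSL ℝ (y - z)) y := by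
    simpa using ((hasFDerivAt_id y).sub_const z).norm_sq
  have h2 := h1.sqrt (pow_ne_zero 2 h0)
  simp only [Real.sqrt_sq (norm_nonneg _)] at h2
  refine h2.congr_fderiv ?_
  ext v
  simp
  field_simp

/-- The derivative of a radial function about `z`. -/
theorem hasFDerivAt_comp_norm_sub {E : Type*} [NormedAddCommGroup E] [InnerProductSpace ℝ E]
    {y z : E} (h : y ≠ z) {F : ℝ → ℂ} {F' : ℂ} (hF : HasDerivAt F F' ‖y - z‖) :
    HasFDerivAt (fun w => F ‖w - z‖)
      ((‖y - z‖⁻¹ • innerSL ℝ (y - z)).smulRight F') y :=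
  (hF.hasFDerivAt.comp y (hasFDerivAt_norm_sub_const h)).congr_fderiv (by
    ext v
    simp
    ring)

theorem hasDerivAt_exp_I_mul (k r : ℝ) :
    HasDerivAt (fun s : ℝ => Complex.exp (Complex.I * k * s))
      (Complex.I * k * Complex.exp (Complex.I * k * r)) r := by
  have h : HasDerivAt (fun s : ℝ => Complex.I * k * (s : ℂ)) (Complex.I * k) r := by
    simpa using (Complex.ofRealCLM.hasDerivAt (x := r)).const_mul (Complex.I * (k : ℂ))
  simpa [mul_comm] using h.cexp

theorem hasDerivAt_radialPhi (k : ℝ) {r : ℝ} (hr : r ≠ 0) :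
    HasDerivAt (fun s : ℝ => Complex.exp (Complex.I * k * s) / (4 * Real.pi * s))
      (Complex.exp (Complex.I * k * r) * (Complex.I * k * r - 1) / (4 * Real.pi * r ^ 2)) r := by
  have hrc : (r : ℂ) ≠ 0 := by exact_mod_cast hr
  have hpi : (Real.pi : ℂ) ≠ 0 := by exact_mod_cast Real.pi_ne_zero
  have hd : HasDerivAt (fun s : ℝ => 4 * (Real.pi : ℂ) * (s : ℂ)) (4 * Real.pi) r := by
    simpa using (Complex.ofRealCLM.hasDerivAt (x := r)).const_mul (4 * (Real.pi : ℂ))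
  refine ((hasDerivAt_exp_I_mul k r).div hd (by simp [hrc, hpi])).congr_deriv ?_
  field_simp

theorem hasDerivAt_radialPhi_deriv_div (k : ℝ) {r : ℝ} (hr : r ≠ 0) :
    HasDerivAt (fun s : ℝ =>
        Complex.exp (Complex.I * k * s) * (Complex.I * k * s - 1) / (4 * Real.pi * s ^ 3))
      (Complex.exp (Complex.I * k * r) * (3 - 3 * Complex.I * k * r - k ^ 2 * r ^ 2) /
        (4 * Real.pi * r ^ 4)) r := by
  have hrc : (r : ℂ) ≠ 0 := by exact_mod_cast hr
  have hpi : (Real.pi : ℂ) ≠ 0 := by exact_mod_cast Real.pi_ne_zero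
  have hc := Complex.ofRealCLM.hasDerivAt (x := r)
  simp only [Complex.ofRealCLM_apply, Complex.ofReal_one] at hc
  have hn := (hasDerivAt_exp_I_mul k r).mul ((hc.const_mul (Complex.I * (k : ℂ))).sub_const 1)
  have hd := (hc.pow 3).const_mul (4 * (Real.pi : ℂ))
  refine (hn.div hd (by simp [hrc, hpi])).congr_deriv ?_
  simp only [Pi.mul_apply, Pi.pow_apply, Complex.ofRealCLM_apply]
  field_simp
  ring_nf
  simp only [Complex.I_sq]
  ring

theorem fderiv_Phi_single (k : ℝ) {y z : EuclideanSpace ℝ (Fin 3)} (h : y ≠ z) (j : Fin 3) :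
    fderiv ℝ (fun w => Phi k w z) y (EuclideanSpace.single j 1) =
      Complex.exp (Complex.I * k * ‖y - z‖) * (Complex.I * k * ‖y - z‖ - 1) /
        (4 * Real.pi * ‖y - z‖ ^ 3) * ((y j - z j : ℝ) : ℂ) := by
  have h0 : ‖y - z‖ ≠ 0 := norm_ne_zero_iff.2 (sub_ne_zero.2 h)
  have hrc : (‖y - z‖ : ℂ) ≠ 0 := by exact_mod_cast h0
  have hpi : (Real.pi : ℂ) ≠ 0 := by exact_mod_cast Real.pi_ne_zero
  have hf : HasFDerivAt (fun w => Phi k w z) _ y :=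
    hasFDerivAt_comp_norm_sub h (hasDerivAt_radialPhi k h0)
  rw [hf.fderiv]
  simp [EuclideanSpace.inner_single_right]
  field_simp

theorem PhiHess_apply (k : ℝ) {x z : EuclideanSpace ℝ (Fin 3)} (h : x ≠ z) (i j : Fin 3) :
    PhiHess k x z i j =
      Complex.exp (Complex.I * k * ‖x - z‖) *
          (3 - 3 * Complex.I * k * ‖x - z‖ - k ^ 2 * ‖x - z‖ ^ 2) / (4 * Real.pi * ‖x - z‖ ^ 5) *
          (((x i - z i : ℝ) : ℂ) * ((x j - z j : ℝ) : ℂ)) +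
        Complex.exp (Complex.I * k * ‖x - z‖) * (Complex.I * k * ‖x - z‖ - 1) /
          (4 * Real.pi * ‖x - z‖ ^ 3) * (1 : Matrix (Fin 3) (Fin 3) ℂ) i j := by
  have h0 : ‖x - z‖ ≠ 0 := norm_ne_zero_iff.2 (sub_ne_zero.2 h)
  have hrc : (‖x - z‖ : ℂ) ≠ 0 := by exact_mod_cast h0
  have hpi : (Real.pi : ℂ) ≠ 0 := by exact_mod_cast Real.pi_ne_zero
  have he : (fun y => fderiv ℝ (fun w => Phi k w z) y (EuclideanSpace.single j 1)) =ᶠ[nhds x]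
      fun y => Complex.exp (Complex.I * k * ‖y - z‖) * (Complex.I * k * ‖y - z‖ - 1) /
        (4 * Real.pi * ‖y - z‖ ^ 3) * ((y j - z j : ℝ) : ℂ) := by
    filter_upwards [isOpen_ne.mem_nhds h] with y hy using fderiv_Phi_single k hy j
  have hc : HasFDerivAt (fun y : EuclideanSpace ℝ (Fin 3) => ((y j - z j : ℝ) : ℂ))
      (Complex.ofRealCLM.comp (EuclideanSpace.proj j)) x :=
    Complex.ofRealCLM.hasFDerivAt.comp x
      ((EuclideanSpace.proj (𝕜 := ℝ) j).hasFDerivAt.sub_const (z j))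
  have hg := (hasFDerivAt_comp_norm_sub h (hasDerivAt_radialPhi_deriv_div k h0)).mul hc
  rw [PhiHess, Matrix.of_apply, he.fderiv_eq]
  refine (congrArg (fun L => L (EuclideanSpace.single i 1)) hg.fderiv).trans ?_
  simp [EuclideanSpace.inner_single_right, Matrix.one_apply, PiLp.single_apply, eq_comm (a := j)]
  split_ifs <;> push_cast <;> field_simp <;> ring

theorem norm_I_mul_exp_sub_le {t : ℝ} (ht : 0 ≤ t) :
    ‖Complex.I * t * Complex.exp (Complex.I * t) - (Complex.exp (Complex.I * t) - 1)‖
      ≤ 2 * t ^ 2 := by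
  have hu : ‖Complex.exp (Complex.I * t)‖ = 1 := by
    rw [mul_comm]; exact Complex.norm_exp_ofReal_mul_I t
  have hIt : ‖Complex.I * (t : ℂ)‖ = t := by simp [abs_of_nonneg ht]
  rcases le_total t 1 with h | h
  · have h1 := Complex.norm_exp_sub_one_sub_id_le (x := -(Complex.I * t))
      (by rw [norm_neg, hIt]; exact h)
    rw [norm_neg, hIt] at h1
    have h2 : Complex.I * t * Complex.exp (Complex.I * t) - (Complex.exp (Complex.I * t) - 1) =
        Complex.exp (Complex.I * t) *
          (Complex.exp (-(Complex.I * t)) - 1 - -(Complex.I * t)) := by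
      rw [Complex.exp_neg]
      field_simp [Complex.exp_ne_zero]
      ring
    rw [h2, norm_mul, hu]
    nlinarith
  · refine (norm_sub_le _ _).trans ?_
    have h1 := Real.norm_exp_I_mul_ofReal_sub_one_le (x := t)
    rw [Real.norm_of_nonneg ht] at h1
    rw [norm_mul, hu, hIt]
    nlinarith

theorem norm_toEuclideanCLM_vecMulVec_star_le {n : Type*} [Fintype n] [DecidableEq n]
    (v : EuclideanSpace ℂ n) :
    ‖Matrix.toEuclideanCLM (𝕜 := ℂ) (Matrix.vecMulVec v (star v.ofLp))‖ ≤ ‖v‖ ^ 2 := by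
  refine ContinuousLinearMap.opNorm_le_bound _ (by positivity) fun y => ?_
  have h : Matrix.toEuclideanCLM (𝕜 := ℂ) (Matrix.vecMulVec v (star v.ofLp)) y =
      inner ℂ v y • v := by
    ext i
    simp [Matrix.vecMulVec_mulVec, EuclideanSpace.inner_eq_star_dotProduct, dotProduct_comm, mul_comm]
  rw [h, norm_smul]
  nlinarith [norm_inner_le_norm (𝕜 := ℂ) v y, norm_nonneg v]

theorem PiK_sub_PiK_zero (k : ℝ) {x z : EuclideanSpace ℝ (Fin 3)} (h : x ≠ z)
    {v : EuclideanSpace ℂ (Fin 3)} (hv : ∀ i, v i = ((x i - z i : ℝ) : ℂ)) {t u w : ℂ}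
    (ht : t = k * ‖x - z‖) (hu : u = Complex.exp (Complex.I * t))
    (hw : w = Complex.I * t * u - (u - 1)) :
    PiK k x z - PiK 0 x z =
      ((t ^ 2 * u + w) / (4 * Real.pi * ‖x - z‖ ^ 3)) • (1 : Matrix (Fin 3) (Fin 3) ℂ) +
        ((-(t ^ 2 * u) - 3 * w) / (4 * Real.pi * ‖x - z‖ ^ 5)) •
          Matrix.vecMulVec v (star v.ofLp) := by
  have h0 : ‖x - z‖ ≠ 0 := norm_ne_zero_iff.2 (sub_ne_zero.2 h)
  have hrc : (‖x - z‖ : ℂ) ≠ 0 := by exact_mod_cast h0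
  have hpi : (Real.pi : ℂ) ≠ 0 := by exact_mod_cast Real.pi_ne_zero
  have hexp : Complex.exp (Complex.I * k * ‖x - z‖) = u := by rw [hu, ht, mul_assoc]
  ext i j
  simp only [PiK, Phi, Matrix.sub_apply, Matrix.add_apply, Matrix.smul_apply, PhiHess_apply _ h,
    Matrix.vecMulVec_apply, Pi.star_apply, hv, RCLike.star_def, Complex.conj_ofReal, smul_eq_mul,
    hexp, Complex.ofReal_zero, mul_zero, zero_mul, Complex.exp_zero]
  rw [hw, ht]
  field_simp
  ring

/-- **Kernel difference bound.** For `k ≥ 0` and all `x ≠ z` in `ℝ³`, the matrix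
`Π_k(x,z) − Π_0(x,z)` satisfies the Euclidean operator-norm bound
`‖Π_k(x,z) − Π_0(x,z)‖ ≤ 3k²/|x−z| + k³`. -/
theorem stmt_6 (k : ℝ) (hk : 0 ≤ k) (x z : EuclideanSpace ℝ (Fin 3)) (hxz : x ≠ z) :
    ‖Matrix.toEuclideanCLM (𝕜 := ℂ) (PiK k x z - PiK 0 x z)‖
      ≤ 3 * k ^ 2 / ‖x - z‖ + k ^ 3 := by
  have hr : 0 < ‖x - z‖ := norm_pos_iff.2 (sub_ne_zero.2 hxz)
  have ht : 0 ≤ k * ‖x - z‖ := by positivity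
  let v : EuclideanSpace ℂ (Fin 3) := WithLp.toLp 2 fun i => ((x i - z i : ℝ) : ℂ)
  have hv : ‖v‖ = ‖x - z‖ := by
    simp only [EuclideanSpace.norm_eq, v, Complex.norm_real, PiLp.sub_apply]
  rw [PiK_sub_PiK_zero k hxz (v := v) (fun _ => rfl) (Complex.ofReal_mul k ‖x - z‖) rfl rfl]
  have hw := norm_I_mul_exp_sub_le ht
  have hu : ‖((k * ‖x - z‖ : ℝ) : ℂ) ^ 2 * Complex.exp (Complex.I * (k * ‖x - z‖ : ℝ))‖ =
      (k * ‖x - z‖) ^ 2 := by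
    rw [norm_mul, mul_comm Complex.I, Complex.norm_exp_ofReal_mul_I, mul_one, norm_pow,
      Complex.norm_real, Real.norm_of_nonneg ht]
  generalize Complex.I * ((k * ‖x - z‖ : ℝ) : ℂ) * Complex.exp (Complex.I * (k * ‖x - z‖ : ℝ)) -
    (Complex.exp (Complex.I * (k * ‖x - z‖ : ℝ)) - 1) = w at hw ⊢
  generalize ((k * ‖x - z‖ : ℝ) : ℂ) ^ 2 * Complex.exp (Complex.I * (k * ‖x - z‖ : ℝ)) = p
    at hu ⊢
  have hden (m : ℕ) : ‖(4 * Real.pi * ‖x - z‖ ^ m : ℂ)‖ = 4 * Real.pi * ‖x - z‖ ^ m := by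
    simp [abs_of_pos Real.pi_pos]
  have hP := norm_toEuclideanCLM_vecMulVec_star_le v
  rw [hv] at hP
  rw [map_add, map_smul, map_smul, map_one]
  calc _ ≤ ‖(p + w) / (4 * Real.pi * ‖x - z‖ ^ 3 : ℂ)‖ * 1 +
        ‖(-p - 3 * w) / (4 * Real.pi * ‖x - z‖ ^ 5 : ℂ)‖ * ‖x - z‖ ^ 2 := by
        refine (norm_add_le _ _).trans (add_le_add ?_ ?_)
        · rw [norm_smul]
          gcongr
          exact ContinuousLinearMap.norm_id_le
        · rw [norm_smul]
          gcongr
    _ = (‖p + w‖ + ‖-p - 3 * w‖) / (4 * Real.pi * ‖x - z‖ ^ 3) := by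
        rw [norm_div, norm_div, hden, hden]
        have := Real.pi_pos
        field_simp
    _ ≤ 12 * Real.pi * (k * ‖x - z‖) ^ 2 / (4 * Real.pi * ‖x - z‖ ^ 3) := by
        gcongr
        have h1 := norm_add_le p w
        have h2 := norm_sub_le (-p) (3 * w)
        have h3 : ‖3 * w‖ = 3 * ‖w‖ := by simp
        rw [norm_neg] at h2
        nlinarith [Real.pi_gt_three, sq_nonneg (k * ‖x - z‖)]
    _ = 3 * k ^ 2 / ‖x - z‖ := by
        have := Real.pi_pos
        field_simp
        ring
    _ ≤ _ := le_add_of_nonneg_right (by positivity)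

end
end

section
/- Let Ω ⊂ ℝ³ be a bounded measurable set, k ≥ 0, and f : Ω → ℂ³ a bounded measurable function. Define g(x) := ∫_Ω (Φ_k(x,z) − Φ_0(x,z)) f(z) dz for x ∈ ℝ³. Then sup_{x∈ℝ³} |g(x)| ≤ (k/(4π)) |Ω| ‖f‖_∞ and g is Lipschitz continuous with |g(x) − g(y)| ≤ (k²/(8π)) |Ω| ‖f‖_∞ |x − y| for all x, y ∈ ℝ³, where |Ω| denotes the Lebesgue measure of Ω and ‖f‖_∞ its essential supremum norm. -/
open MeasureTheory

noncomputable section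

/-- The kernel `(e^{iar} - 1)/r` as an average of unimodular exponentials. -/
lemma exp_sub_one_div_eq_integral (a r : ℝ) (hr : r ≠ 0) :
    (Complex.exp (Complex.I * (a * r : ℝ)) - 1) / (r : ℂ) =
      Complex.I * a * ∫ s in (0 : ℝ)..1, Complex.exp (Complex.I * (a * r * s : ℝ)) := by
  rcases eq_or_ne a 0 with rfl | ha
  · simp
  have hc : Complex.I * (a * r : ℝ) ≠ 0 :=
    mul_ne_zero Complex.I_ne_zero (by exact_mod_cast mul_ne_zero ha hr)
  have h := integral_exp_mul_complex (a := 0) (b := 1) hc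
  have h2 : ∀ s : ℝ, Complex.exp (Complex.I * (a * r * s : ℝ)) =
      Complex.exp (Complex.I * (a * r : ℝ) * s) := fun s => by push_cast; ring_nf
  simp_rw [h2, h]
  have ha' : (a : ℂ) ≠ 0 := by exact_mod_cast ha
  have hr' : (r : ℂ) ≠ 0 := by exact_mod_cast hr
  simp only [Complex.ofReal_one, mul_one, Complex.ofReal_zero, mul_zero, Complex.exp_zero,
    Complex.ofReal_mul]
  field_simp [Complex.I_ne_zero]

lemma norm_exp_I_mul_sub_exp_I_mul_le (a b : ℝ) :
    ‖Complex.exp (Complex.I * a) - Complex.exp (Complex.I * b)‖ ≤ |a - b| := by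
  have h : Complex.exp (Complex.I * a) - Complex.exp (Complex.I * b) =
      Complex.exp (Complex.I * b) * (Complex.exp (Complex.I * (a - b : ℝ)) - 1) := by
    rw [mul_sub, ← Complex.exp_add]
    push_cast
    ring_nf
  rw [h, norm_mul, Complex.norm_exp_I_mul_ofReal, one_mul]
  exact Real.norm_exp_I_mul_ofReal_sub_one_le

lemma norm_exp_sub_one_div_sub_le (a r s : ℝ) (hr : r ≠ 0) (hs : s ≠ 0) :
    ‖(Complex.exp (Complex.I * (a * r : ℝ)) - 1) / (r : ℂ) -
      (Complex.exp (Complex.I * (a * s : ℝ)) - 1) / (s : ℂ)‖ ≤ a ^ 2 / 2 * |r - s| := by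
  rw [exp_sub_one_div_eq_integral a r hr, exp_sub_one_div_eq_integral a s hs, ← mul_sub,
    ← intervalIntegral.integral_sub (Continuous.intervalIntegrable (by fun_prop) _ _)
      (Continuous.intervalIntegrable (by fun_prop) _ _), norm_mul, norm_mul, Complex.norm_I,
    one_mul, Complex.norm_real, Real.norm_eq_abs]
  have h : ‖∫ t in (0 : ℝ)..1, (Complex.exp (Complex.I * (a * r * t : ℝ)) -
      Complex.exp (Complex.I * (a * s * t : ℝ)))‖ ≤ ∫ t in (0 : ℝ)..1, |a| * |r - s| * t := by
    refine intervalIntegral.norm_integral_le_of_norm_le zero_le_one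
      (Filter.Eventually.of_forall fun t ht => ?_)
      (Continuous.intervalIntegrable (by fun_prop) _ _)
    refine (norm_exp_I_mul_sub_exp_I_mul_le _ _).trans_eq ?_
    rw [show a * r * t - a * s * t = a * (r - s) * t by ring, abs_mul, abs_mul, abs_of_pos ht.1]
  rw [intervalIntegral.integral_const_mul, integral_id] at h
  calc _ ≤ |a| * (|a| * |r - s| * ((1 ^ 2 - 0 ^ 2) / 2)) :=
        mul_le_mul_of_nonneg_left h (abs_nonneg a)
    _ = |a| ^ 2 / 2 * |r - s| := by ring
    _ = _ := by rw [sq_abs]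

lemma Phi_sub_Phi_zero (k : ℝ) (x z : EuclideanSpace ℝ (Fin 3)) :
    Phi k x z - Phi 0 x z = ((4 * Real.pi : ℝ) : ℂ)⁻¹ *
      ((Complex.exp (Complex.I * (k * ‖x - z‖ : ℝ)) - 1) / (‖x - z‖ : ℂ)) := by
  simp only [Phi, Complex.ofReal_zero, mul_zero, zero_mul, Complex.exp_zero, ← sub_div]
  push_cast
  rw [← mul_assoc Complex.I, div_mul_eq_div_div_swap, inv_mul_eq_div]

lemma norm_Phi_sub_Phi_zero_le {k : ℝ} (hk : 0 ≤ k) (x z : EuclideanSpace ℝ (Fin 3)) :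
    ‖Phi k x z - Phi 0 x z‖ ≤ k / (4 * Real.pi) := by
  have hpi := Real.pi_pos
  rw [Phi_sub_Phi_zero, norm_mul, norm_inv, Complex.norm_real, Real.norm_of_nonneg (by positivity),
    inv_mul_eq_div]
  gcongr
  rw [norm_div, Complex.norm_real, norm_norm]
  refine div_le_of_le_mul₀ (norm_nonneg _) hk ?_
  refine Real.norm_exp_I_mul_ofReal_sub_one_le.trans_eq ?_
  rw [Real.norm_of_nonneg (by positivity)]

lemma norm_Phi_sub_Phi_zero_sub_le (k : ℝ) {x y z : EuclideanSpace ℝ (Fin 3)} (hx : x ≠ z)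
    (hy : y ≠ z) :
    ‖(Phi k x z - Phi 0 x z) - (Phi k y z - Phi 0 y z)‖ ≤
      k ^ 2 / (8 * Real.pi) * ‖x - y‖ := by
  have hpi := Real.pi_pos
  rw [Phi_sub_Phi_zero, Phi_sub_Phi_zero, ← mul_sub, norm_mul, norm_inv, Complex.norm_real,
    Real.norm_of_nonneg (by positivity)]
  have h := norm_exp_sub_one_div_sub_le k ‖x - z‖ ‖y - z‖
    (norm_ne_zero_iff.2 (sub_ne_zero.2 hx)) (norm_ne_zero_iff.2 (sub_ne_zero.2 hy))
  have h' : |‖x - z‖ - ‖y - z‖| ≤ ‖x - y‖ := by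
    simpa using abs_norm_sub_norm_le (x - z) (y - z)
  calc _ ≤ (4 * Real.pi)⁻¹ * (k ^ 2 / 2 * ‖x - y‖) := by gcongr; exact h.trans (by gcongr)
    _ = _ := by field_simp; ring

lemma measurable_Phi (k : ℝ) (x : EuclideanSpace ℝ (Fin 3)) : Measurable (Phi k x) := by
  unfold Phi
  fun_prop

lemma integrableOn_Phi_sub_Phi_zero_smul {Ω : Set (EuclideanSpace ℝ (Fin 3))}
    (hΩb : Bornology.IsBounded Ω) {k : ℝ} (hk : 0 ≤ k)
    {f : EuclideanSpace ℝ (Fin 3) → EuclideanSpace ℂ (Fin 3)}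
    (hf : AEStronglyMeasurable f (volume.restrict Ω)) {C : ℝ}
    (hfC : ∀ᵐ z ∂volume.restrict Ω, ‖f z‖ ≤ C) (x : EuclideanSpace ℝ (Fin 3)) :
    IntegrableOn (fun z => (Phi k x z - Phi 0 x z) • f z) Ω := by
  refine IntegrableOn.of_bound hΩb.measure_lt_top
    (((measurable_Phi k x).sub (measurable_Phi 0 x)).aestronglyMeasurable.smul hf)
    (k / (4 * Real.pi) * C) ?_
  filter_upwards [hfC] with z hz
  rw [norm_smul]
  have := norm_Phi_sub_Phi_zero_le hk x z
  gcongr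

/-- **Bounds for the potential with the smooth difference kernel `Φ_k − Φ_0`.**
For bounded measurable `f : Ω → ℂ³` with `‖f‖_∞ ≤ C`, the function
`g(x) = ∫_Ω (Φ_k − Φ_0)(x,z) f(z) dz` satisfies `|g| ≤ (k/4π)|Ω|C` everywhere and is
Lipschitz with constant `(k²/8π)|Ω|C`. -/
theorem stmt_10 (Ω : Set (EuclideanSpace ℝ (Fin 3)))
    (hΩm : MeasurableSet Ω) (hΩb : Bornology.IsBounded Ω)
    (k : ℝ) (hk : 0 ≤ k)
    (f : EuclideanSpace ℝ (Fin 3) → EuclideanSpace ℂ (Fin 3)) (hf : AEStronglyMeasurable f (volume.restrict Ω))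
    (C : ℝ) (hfC : ∀ᵐ z ∂volume.restrict Ω, ‖f z‖ ≤ C) :
    (∀ x, ‖∫ z in Ω, (Phi k x z - Phi 0 x z) • f z‖
        ≤ k / (4 * Real.pi) * (volume Ω).toReal * C) ∧
    ∀ x y, ‖(∫ z in Ω, (Phi k x z - Phi 0 x z) • f z)
          - ∫ z in Ω, (Phi k y z - Phi 0 y z) • f z‖
        ≤ k ^ 2 / (8 * Real.pi) * (volume Ω).toReal * C * ‖x - y‖ := by
  have hfin : IsFiniteMeasure (volume.restrict Ω) := ⟨by simpa using hΩb.measure_lt_top⟩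
  constructor
  · intro x
    have h := norm_integral_le_of_norm_le_const (μ := volume.restrict Ω)
      (f := fun z => (Phi k x z - Phi 0 x z) • f z) (C := k / (4 * Real.pi) * C) (by
        filter_upwards [hfC] with z hz
        rw [norm_smul]
        have := norm_Phi_sub_Phi_zero_le hk x z
        gcongr)
    refine h.trans_eq ?_
    rw [measureReal_restrict_apply_univ, measureReal_def]
    ring
  · intro x y
    rw [← integral_sub (integrableOn_Phi_sub_Phi_zero_smul hΩb hk hf hfC x)
      (integrableOn_Phi_sub_Phi_zero_smul hΩb hk hf hfC y)]
    have hne : ∀ w : EuclideanSpace ℝ (Fin 3), ∀ᵐ z ∂volume.restrict Ω, z ≠ w :=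
      fun w => Measure.ae_ne _ w
    refine (norm_integral_le_of_norm_le_const (μ := volume.restrict Ω)
      (C := k ^ 2 / (8 * Real.pi) * ‖x - y‖ * C) ?_).trans_eq ?_
    · filter_upwards [hfC, hne x, hne y] with z hz hzx hzy
      rw [← sub_smul, norm_smul]
      have := norm_Phi_sub_Phi_zero_sub_le k hzx.symm hzy.symm
      gcongr
    · rw [measureReal_restrict_apply_univ, measureReal_def]
      ring

end
end
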